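/- arXiv:1807.08594 — 2 statements merged into one kernel-verified Lean document; each statement's English description precedes it below -/
import Mathlib

section
/- Let Y_{ab} be a smooth Yano tensor of rank two on U. Then its second covariant derivative satisfies the integrability condition 2∇_d∇_cY_{ab} = 2Y_{ma}R^m_{dbc} + Y_{mb}R^m_{acd} + Y_{mc}R^m_{adb} + Y_{md}R^m_{acb}, where ∇_d∇_cY_{ab} denotes the covariant derivative of the (0,3)-tensor ∇_cY_{ab} and the sum over m is understood. -/
/-!
STATEMENT 3: For a Yano tensor `Y` of rank two, the integrability condition
`2∇_d∇_cY_{ab} = 2Y_{ma}R^m_{dbc} + Y_{mb}R^m_{acd} + Y_{mc}R^m_{adb} + Y_{md}R^m_{acb}` holds.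
-/

noncomputable section

abbrev Pt : Type := Fin 4 → ℝ

/-- Partial derivative of a scalar field in the `c`-th coordinate direction. -/
def pd (f : Pt → ℝ) (c : Fin 4) (p : Pt) : ℝ := fderiv ℝ f p (Pi.single c 1)

/-- Covariant derivative `∇_c Y_{ab}` of a (0,2)-tensor field. -/
def cov2 (Γ : Fin 4 → Fin 4 → Fin 4 → Pt → ℝ) (Y : Fin 4 → Fin 4 → Pt → ℝ)
    (c a b : Fin 4) (p : Pt) : ℝ :=
  pd (Y a b) c p - ∑ m, Γ m c a p * Y m b p - ∑ m, Γ m c b p * Y a m p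

/-- The curvature tensor `R^m_{acd}` of the connection `Γ`. -/
def Riem (Γ : Fin 4 → Fin 4 → Fin 4 → Pt → ℝ) (m a c d : Fin 4) (p : Pt) : ℝ :=
  pd (Γ m d a) c p - pd (Γ m c a) d p
    + ∑ n, Γ m c n p * Γ n d a p - ∑ n, Γ m d n p * Γ n c a p

/-- Covariant derivative `∇_d T_{cab}` of a (0,3)-tensor field. -/
def cov3 (Γ : Fin 4 → Fin 4 → Fin 4 → Pt → ℝ) (T : Fin 4 → Fin 4 → Fin 4 → Pt → ℝ)
    (d c a b : Fin 4) (p : Pt) : ℝ :=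
  pd (T c a b) d p - ∑ m, Γ m d c p * T m a b p - ∑ m, Γ m d a p * T c m b p
    - ∑ m, Γ m d b p * T c a m p

open Filter Topology

theorem pd_congr {f g : Pt → ℝ} {p : Pt} (h : f =ᶠ[𝓝 p] g) (c : Fin 4) : pd f c p = pd g c p := by
  rw [pd, pd, h.fderiv_eq]

theorem pd_neg (f : Pt → ℝ) (c : Fin 4) (p : Pt) : pd (fun q => -f q) c p = -pd f c p := by
  simp [pd, fderiv_fun_neg]

theorem pd_sub {f g : Pt → ℝ} {p : Pt} (hf : DifferentiableAt ℝ f p) (hg : DifferentiableAt ℝ g p)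
    (c : Fin 4) : pd (fun q => f q - g q) c p = pd f c p - pd g c p := by
  simp [pd, fderiv_fun_sub hf hg]

theorem pd_sum_mul {ι : Type*} [Fintype ι] {f g : ι → Pt → ℝ} {p : Pt}
    (hf : ∀ i, DifferentiableAt ℝ (f i) p) (hg : ∀ i, DifferentiableAt ℝ (g i) p) (c : Fin 4) :
    pd (fun q => ∑ i, f i q * g i q) c p
      = ∑ i, (pd (f i) c p * g i p + f i p * pd (g i) c p) := by
  rw [pd, fderiv_fun_sum fun i _ => (hf i).fun_mul (hg i)]
  simp only [sum_apply, fderiv_fun_mul (hf _) (hg _), pd, add_apply, smul_apply, smul_eq_mul]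
  exact Finset.sum_congr rfl fun i _ => by ring

theorem differentiableAt_pd {f : Pt → ℝ} {p : Pt} (hf : ContDiffAt ℝ 2 f p) (c : Fin 4) :
    DifferentiableAt ℝ (pd f c) p :=
  ((hf.fderiv_right (m := 1) (by norm_num)).differentiableAt (by norm_num)).clm_apply
    (differentiableAt_const _)

theorem pd_comm {f : Pt → ℝ} {p : Pt} (hf : ContDiffAt ℝ 2 f p) (c d : Fin 4) :
    pd (pd f c) d p = pd (pd f d) c p := by
  have hd : DifferentiableAt ℝ (fderiv ℝ f) p :=
    (hf.fderiv_right (m := 1) (by norm_num)).differentiableAt (by norm_num)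
  have key : ∀ c d, pd (pd f c) d p
      = fderiv ℝ (fderiv ℝ f) p (Pi.single d 1) (Pi.single c 1) := by
    intro c d
    change fderiv ℝ (fun q => fderiv ℝ f q (Pi.single c 1)) p (Pi.single d 1) = _
    rw [fderiv_clm_apply hd (differentiableAt_const _)]
    simp
  rw [key, key]
  exact (hf.isSymmSndFDerivAt (by simp)) _ _

theorem Riem_antisymm (Γ : Fin 4 → Fin 4 → Fin 4 → Pt → ℝ) (m a c d : Fin 4) (p : Pt) :
    Riem Γ m a c d p = -Riem Γ m a d c p := by
  simp only [Riem]
  ring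

/-- The first Bianchi identity for a torsion-free connection. -/
theorem Riem_cyclic (Γ : Fin 4 → Fin 4 → Fin 4 → Pt → ℝ) {p : Pt}
    (hΓ : ∀ m a b, Γ m a b =ᶠ[𝓝 p] Γ m b a) (m a c d : Fin 4) :
    Riem Γ m a c d p + Riem Γ m c d a p + Riem Γ m d a c p = 0 := by
  simp only [Riem, pd_congr (hΓ m d a), pd_congr (hΓ m c a), pd_congr (hΓ m d c),
    (hΓ _ d a).eq_of_nhds, (hΓ _ c a).eq_of_nhds, (hΓ _ d c).eq_of_nhds]
  ring

theorem cov2_antisymm (Γ : Fin 4 → Fin 4 → Fin 4 → Pt → ℝ) (Y : Fin 4 → Fin 4 → Pt → ℝ) {p : Pt}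
    (hY : ∀ a b, Y a b =ᶠ[𝓝 p] fun q => -Y b a q) (c a b : Fin 4) :
    cov2 Γ Y c a b p = -cov2 Γ Y c b a p := by
  simp only [cov2, pd_congr (hY a b), pd_neg, fun m => (hY m b).eq_of_nhds,
    fun m => (hY a m).eq_of_nhds, mul_neg, Finset.sum_neg_distrib]
  ring

theorem cov3_antisymm_left (Γ T : Fin 4 → Fin 4 → Fin 4 → Pt → ℝ) {p : Pt}
    (hT : ∀ c a b, T c a b =ᶠ[𝓝 p] fun q => -T a c b q) (d c a b : Fin 4) :
    cov3 Γ T d c a b p = -cov3 Γ T d a c b p := by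
  simp only [cov3, pd_congr (hT c a b), pd_neg, fun m => (hT m a b).eq_of_nhds,
    fun m => (hT c m b).eq_of_nhds, fun m => (hT c a m).eq_of_nhds, mul_neg,
    Finset.sum_neg_distrib]
  ring

theorem cov3_antisymm_right (Γ T : Fin 4 → Fin 4 → Fin 4 → Pt → ℝ) {p : Pt}
    (hT : ∀ c a b, T c a b =ᶠ[𝓝 p] fun q => -T c b a q) (d c a b : Fin 4) :
    cov3 Γ T d c a b p = -cov3 Γ T d c b a p := by
  simp only [cov3, pd_congr (hT c a b), pd_neg, fun m => (hT m a b).eq_of_nhds,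
    fun m => (hT c m b).eq_of_nhds, fun m => (hT c a m).eq_of_nhds, mul_neg,
    Finset.sum_neg_distrib]
  ring

theorem pd_cov2 (Γ : Fin 4 → Fin 4 → Fin 4 → Pt → ℝ) (Y : Fin 4 → Fin 4 → Pt → ℝ) {p : Pt}
    (hΓ : ∀ m a b, DifferentiableAt ℝ (Γ m a b) p) (hY : ∀ a b, ContDiffAt ℝ 2 (Y a b) p)
    (d c a b : Fin 4) :
    pd (cov2 Γ Y c a b) d p = pd (pd (Y a b) c) d p
      - ∑ m, (pd (Γ m c a) d p * Y m b p + Γ m c a p * pd (Y m b) d p)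
      - ∑ m, (pd (Γ m c b) d p * Y a m p + Γ m c b p * pd (Y a m) d p) := by
  have hYd : ∀ a b, DifferentiableAt ℝ (Y a b) p := fun a b => (hY a b).differentiableAt (by simp)
  have h₁ : DifferentiableAt ℝ (fun q => ∑ m, Γ m c a q * Y m b q) p :=
    DifferentiableAt.fun_sum fun m _ => (hΓ m c a).mul (hYd m b)
  have h₂ : DifferentiableAt ℝ (fun q => ∑ m, Γ m c b q * Y a m q) p :=
    DifferentiableAt.fun_sum fun m _ => (hΓ m c b).mul (hYd a m)
  have h₀ := differentiableAt_pd (hY a b) c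
  rw [← pd_sum_mul (fun m => hΓ m c a) (fun m => hYd m b),
    ← pd_sum_mul (fun m => hΓ m c b) (fun m => hYd a m), ← pd_sub h₀ h₁,
    ← pd_sub (h₀.fun_sub h₁) h₂]
  rfl

/-- The Ricci identity for a (0,2)-tensor field and a torsion-free connection. -/
theorem cov3_cov2_sub_comm (Γ : Fin 4 → Fin 4 → Fin 4 → Pt → ℝ) (Y : Fin 4 → Fin 4 → Pt → ℝ)
    {p : Pt} (hΓ : ∀ m a b, DifferentiableAt ℝ (Γ m a b) p)
    (hY : ∀ a b, ContDiffAt ℝ 2 (Y a b) p) (hΓs : ∀ m a b, Γ m a b p = Γ m b a p)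
    (d c a b : Fin 4) :
    cov3 Γ (cov2 Γ Y) d c a b p - cov3 Γ (cov2 Γ Y) c d a b p
      = ∑ m, Y m b p * Riem Γ m a c d p + ∑ m, Y a m p * Riem Γ m b c d p := by
  simp only [cov3, pd_cov2 Γ Y hΓ hY, pd_comm (hY a b) d c, hΓs _ d c]
  simp only [cov2, Riem, Fin.sum_univ_four]
  ring

theorem yano_second_derivative_integrability
    (U : Set Pt) (hU : IsOpen U)
    (Γ : Fin 4 → Fin 4 → Fin 4 → Pt → ℝ)
    (hΓsmooth : ∀ m a b, ContDiffOn ℝ (⊤ : ℕ∞) (Γ m a b) U)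
    (hΓsymm : ∀ m a b, ∀ p ∈ U, Γ m a b p = Γ m b a p)
    (Y : Fin 4 → Fin 4 → Pt → ℝ)
    (hYsmooth : ∀ a b, ContDiffOn ℝ (⊤ : ℕ∞) (Y a b) U)
    (hYanti : ∀ a b, ∀ p ∈ U, Y a b p = - Y b a p)
    (hYano : ∀ a b c, ∀ p ∈ U, cov2 Γ Y c b a p + cov2 Γ Y b c a p = 0) :
    ∀ p ∈ U, ∀ a b c d,
      2 * cov3 Γ (cov2 Γ Y) d c a b p =
        2 * (∑ m, Y m a p * Riem Γ m d b c p)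
          + (∑ m, Y m b p * Riem Γ m a c d p)
          + (∑ m, Y m c p * Riem Γ m a d b p)
          + (∑ m, Y m d p * Riem Γ m a c b p) := by
  intro p hp a b c d
  have hΓd : ∀ m a b, DifferentiableAt ℝ (Γ m a b) p := fun m a b =>
    ((hΓsmooth m a b).contDiffAt (hU.mem_nhds hp)).differentiableAt (by simp)
  have hY : ∀ a b, ContDiffAt ℝ 2 (Y a b) p := fun a b =>
    ((hYsmooth a b).contDiffAt (hU.mem_nhds hp)).of_le
      (WithTop.coe_le_coe.2 (le_top : (2 : ℕ∞) ≤ ⊤))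
  have hΓs : ∀ m a b, Γ m a b =ᶠ[𝓝 p] Γ m b a := fun m a b =>
    eventually_of_mem (hU.mem_nhds hp) (hΓsymm m a b)
  have hYa : ∀ q ∈ U, ∀ c a b, cov2 Γ Y c a b q = -cov2 Γ Y c b a q := fun q hq =>
    cov2_antisymm Γ Y fun a b => eventually_of_mem (hU.mem_nhds hq) (hYanti a b)
  have hT₁ : ∀ c a b, cov2 Γ Y c a b =ᶠ[𝓝 p] fun q => -cov2 Γ Y a c b q := fun c a b =>
    eventually_of_mem (hU.mem_nhds hp) fun q hq => eq_neg_of_add_eq_zero_left (hYano b a c q hq)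
  have hT₂ : ∀ c a b, cov2 Γ Y c a b =ᶠ[𝓝 p] fun q => -cov2 Γ Y c b a q := fun c a b =>
    eventually_of_mem (hU.mem_nhds hp) fun q hq => hYa q hq c a b
  have hD₁ := cov3_antisymm_left Γ (cov2 Γ Y) hT₁
  have hD₂ := cov3_antisymm_right Γ (cov2 Γ Y) hT₂
  have hricci : ∀ d c a b, cov3 Γ (cov2 Γ Y) d c a b p - cov3 Γ (cov2 Γ Y) c d a b p
      = ∑ m, Y m b p * Riem Γ m a c d p - ∑ m, Y m a p * Riem Γ m b c d p := by
    intro d c a b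
    rw [cov3_cov2_sub_comm Γ Y hΓd hY fun m a b => (hΓs m a b).eq_of_nhds]
    simp only [fun m => hYanti a m p hp, neg_mul, Finset.sum_neg_distrib, sub_eq_add_neg]
  have hbianchi : ∑ m, Y m a p * Riem Γ m b c d p + ∑ m, Y m a p * Riem Γ m c d b p
      + ∑ m, Y m a p * Riem Γ m d b c p = 0 := by
    simp only [← Finset.sum_add_distrib, ← mul_add, Riem_cyclic Γ hΓs, mul_zero,
      Finset.sum_const_zero]
  have hR : ∀ e a c d, ∑ m, Y m e p * Riem Γ m a c d p = -∑ m, Y m e p * Riem Γ m a d c p := by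
    intro e a c d
    simp only [fun m => Riem_antisymm Γ m a c d p, mul_neg, Finset.sum_neg_distrib]
  linarith [hricci d c b a, hricci c b a d, hricci b d c a, hD₁ c d b a, hD₂ c b d a,
    hD₂ b c a d, hD₁ b c d a, hD₁ d b c a, hD₂ d c a b, hR d a c b]
end
end

section
/- With G and K the contravariant tensors of the Benenti–Francaviglia form and 𝒢(q,p) := Σ_{a,b} G^{ab}(q) p_a p_b, let (q(τ),p(τ)) be a differentiable curve in U × ℝ⁴, defined on an open interval, satisfying Hamilton's equations dq^i/dτ = ∂𝒢/∂p_i and dp_i/dτ = −∂𝒢/∂q^i for each i. Then the function τ ↦ Σ_{a,b} K^{ab}(q(τ)) p_a(τ) p_b(τ) is constant (a 'fourth', Carter-type, integral of the geodesic flow). -/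
/-!
STATEMENT 16: Along any solution of Hamilton's equations for
`𝒢(q,p) = G^{ab}(q)p_ap_b` (with `G` of Benenti–Francaviglia form), the
quantity `𝒦(q(τ),p(τ)) = K^{ab}(q(τ))p_a(τ)p_b(τ)` is a constant of the motion.
-/

noncomputable section

/-- The contravariant metric `G` of the Benenti–Francaviglia form. -/
def BFG (A1 A2 A3 A4 A5 B1 B2 B3 B4 B5 : ℝ → ℝ) (q : Pt) :
    Matrix (Fin 4) (Fin 4) ℝ :=
  (A1 (q 0) + B1 (q 1))⁻¹ •
    Matrix.of ![![A2 (q 0), 0, 0, 0],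
      ![0, B2 (q 1), 0, 0],
      ![0, 0, A3 (q 0) + B3 (q 1), A4 (q 0) + B4 (q 1)],
      ![0, 0, A4 (q 0) + B4 (q 1), A5 (q 0) + B5 (q 1)]]

/-- The contravariant Killing tensor `K` of the Benenti–Francaviglia form. -/
def BFK (A1 A2 A3 A4 A5 B1 B2 B3 B4 B5 : ℝ → ℝ) (q : Pt) :
    Matrix (Fin 4) (Fin 4) ℝ :=
  (A1 (q 0) + B1 (q 1))⁻¹ •
    Matrix.of ![![A2 (q 0) * B1 (q 1), 0, 0, 0],
      ![0, -(B2 (q 1) * A1 (q 0)), 0, 0],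
      ![0, 0, B1 (q 1) * A3 (q 0) - A1 (q 0) * B3 (q 1),
        B1 (q 1) * A4 (q 0) - A1 (q 0) * B4 (q 1)],
      ![0, 0, B1 (q 1) * A4 (q 0) - A1 (q 0) * B4 (q 1),
        B1 (q 1) * A5 (q 0) - A1 (q 0) * B5 (q 1)]]

/-- The quadratic Hamiltonian associated with a contravariant tensor field. -/
def ham (T : Pt → Matrix (Fin 4) (Fin 4) ℝ) (q p : Pt) : ℝ :=
  ∑ a, ∑ b, T q a b * p a * p b

/-- Partial derivative of a phase-space function with respect to the momentum `p i`. -/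
def dP (F : Pt → Pt → ℝ) (i : Fin 4) (q p : Pt) : ℝ :=
  fderiv ℝ (fun p' => F q p') p (Pi.single i 1)

/-- Partial derivative of a phase-space function with respect to the coordinate `q i`. -/
def dQ (F : Pt → Pt → ℝ) (i : Fin 4) (q p : Pt) : ℝ :=
  fderiv ℝ (fun q' => F q' p) q (Pi.single i 1)

section
variable (A1 A2 A3 A4 A5 B1 B2 B3 B4 B5 : ℝ → ℝ)

theorem ham_BFG (q p : Pt) :
    ham (BFG A1 A2 A3 A4 A5 B1 B2 B3 B4 B5) q p =
      (A2 (q 0) * p 0 ^ 2 + B2 (q 1) * p 1 ^ 2 + (A3 (q 0) + B3 (q 1)) * p 2 ^ 2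
        + 2 * (A4 (q 0) + B4 (q 1)) * (p 2 * p 3) + (A5 (q 0) + B5 (q 1)) * p 3 ^ 2)
        / (A1 (q 0) + B1 (q 1)) := by
  simp [ham, BFG, Fin.sum_univ_four]
  ring

theorem ham_BFK (q p : Pt) :
    ham (BFK A1 A2 A3 A4 A5 B1 B2 B3 B4 B5) q p =
      (B1 (q 1) * (A2 (q 0) * p 0 ^ 2 + A3 (q 0) * p 2 ^ 2 + 2 * A4 (q 0) * (p 2 * p 3)
          + A5 (q 0) * p 3 ^ 2)
        - A1 (q 0) * (B2 (q 1) * p 1 ^ 2 + B3 (q 1) * p 2 ^ 2 + 2 * B4 (q 1) * (p 2 * p 3)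
          + B5 (q 1) * p 3 ^ 2))
        / (A1 (q 0) + B1 (q 1)) := by
  simp [ham, BFK, Fin.sum_univ_four]
  ring

/-- A partial derivative is the derivative along the corresponding coordinate line. -/
theorem fderiv_single_eq_deriv_update {f : Pt → ℝ} {x : Pt} (hf : DifferentiableAt ℝ f x)
    (i : Fin 4) :
    fderiv ℝ f x (Pi.single i 1) = deriv (fun s => f (Function.update x i s)) (x i) := by
  have hf' : HasFDerivAt f (fderiv ℝ f x) (Function.update x i (x i)) := by
    simpa using hf.hasFDerivAt
  exact (hf'.comp_hasDerivAt (x i) (hasDerivAt_update x i (x i))).deriv.symm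

theorem differentiableAt_ham_BFG_momentum (q p : Pt) :
    DifferentiableAt ℝ (fun p' => ham (BFG A1 A2 A3 A4 A5 B1 B2 B3 B4 B5) q p') p := by
  simp only [ham_BFG]
  fun_prop

variable {A1 A2 A3 A4 A5 B1 B2 B3 B4 B5}

theorem differentiableAt_ham_BFG_position {q : Pt} (p : Pt)
    (hA : ∀ f ∈ [A1, A2, A3, A4, A5], DifferentiableAt ℝ f (q 0))
    (hB : ∀ f ∈ [B1, B2, B3, B4, B5], DifferentiableAt ℝ f (q 1))
    (hD : A1 (q 0) + B1 (q 1) ≠ 0) :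
    DifferentiableAt ℝ (fun q' => ham (BFG A1 A2 A3 A4 A5 B1 B2 B3 B4 B5) q' p) q := by
  simp only [List.forall_mem_cons, List.not_mem_nil, false_imp_iff, implies_true, and_true] at hA hB
  obtain ⟨h1, h2, h3, h4, h5⟩ := hA
  obtain ⟨k1, k2, k3, k4, k5⟩ := hB
  simp only [ham_BFG]
  have hA' {f : ℝ → ℝ} (h : DifferentiableAt ℝ f (q 0)) :
      DifferentiableAt ℝ (fun q' : Pt => f (q' 0)) q :=
    h.comp (f := fun q' : Pt => q' 0) q (by fun_prop)
  have hB' {f : ℝ → ℝ} (h : DifferentiableAt ℝ f (q 1)) :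
      DifferentiableAt ℝ (fun q' : Pt => f (q' 1)) q :=
    h.comp (f := fun q' : Pt => q' 1) q (by fun_prop)
  have := hA' h1
  have := hA' h2
  have := hA' h3
  have := hA' h4
  have := hA' h5
  have := hB' k1
  have := hB' k2
  have := hB' k3
  have := hB' k4
  have := hB' k5
  fun_prop (disch := assumption)

theorem dP_zero_ham_BFG (q p : Pt) :
    dP (ham (BFG A1 A2 A3 A4 A5 B1 B2 B3 B4 B5)) 0 q p
      = 2 * A2 (q 0) * p 0 / (A1 (q 0) + B1 (q 1)) := by
  rw [dP, fderiv_single_eq_deriv_update (differentiableAt_ham_BFG_momentum ..)]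
  simp [ham_BFG]
  ring

theorem dP_one_ham_BFG (q p : Pt) :
    dP (ham (BFG A1 A2 A3 A4 A5 B1 B2 B3 B4 B5)) 1 q p
      = 2 * B2 (q 1) * p 1 / (A1 (q 0) + B1 (q 1)) := by
  rw [dP, fderiv_single_eq_deriv_update (differentiableAt_ham_BFG_momentum ..)]
  simp [ham_BFG]
  ring

theorem dQ_zero_ham_BFG {q : Pt} (p : Pt)
    (hA : ∀ f ∈ [A1, A2, A3, A4, A5], DifferentiableAt ℝ f (q 0))
    (hB : ∀ f ∈ [B1, B2, B3, B4, B5], DifferentiableAt ℝ f (q 1))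
    (hD : A1 (q 0) + B1 (q 1) ≠ 0) :
    dQ (ham (BFG A1 A2 A3 A4 A5 B1 B2 B3 B4 B5)) 0 q p
      = (deriv A2 (q 0) * p 0 ^ 2 + deriv A3 (q 0) * p 2 ^ 2
          + 2 * deriv A4 (q 0) * (p 2 * p 3) + deriv A5 (q 0) * p 3 ^ 2
          - deriv A1 (q 0) * ham (BFG A1 A2 A3 A4 A5 B1 B2 B3 B4 B5) q p)
        / (A1 (q 0) + B1 (q 1)) := by
  rw [dQ, fderiv_single_eq_deriv_update (differentiableAt_ham_BFG_position p hA hB hD)]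
  simp only [List.forall_mem_cons, List.not_mem_nil, false_imp_iff, implies_true, and_true] at hA
  obtain ⟨h1, h2, h3, h4, h5⟩ := hA
  simp only [ham_BFG, Function.update_self, ne_eq, one_ne_zero, not_false_eq_true,
    Function.update_of_ne]
  have h := (((((h2.hasDerivAt.mul_const (p 0 ^ 2)).add_const (B2 (q 1) * p 1 ^ 2)).add
    ((h3.hasDerivAt.add_const (B3 (q 1))).mul_const (p 2 ^ 2))).add
    (((h4.hasDerivAt.add_const (B4 (q 1))).const_mul 2).mul_const (p 2 * p 3))).add
    ((h5.hasDerivAt.add_const (B5 (q 1))).mul_const (p 3 ^ 2))).div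
    (h1.hasDerivAt.add_const (B1 (q 1))) hD
  refine h.deriv.trans ?_
  simp only [Pi.add_apply]
  field_simp

theorem dQ_one_ham_BFG {q : Pt} (p : Pt)
    (hA : ∀ f ∈ [A1, A2, A3, A4, A5], DifferentiableAt ℝ f (q 0))
    (hB : ∀ f ∈ [B1, B2, B3, B4, B5], DifferentiableAt ℝ f (q 1))
    (hD : A1 (q 0) + B1 (q 1) ≠ 0) :
    dQ (ham (BFG A1 A2 A3 A4 A5 B1 B2 B3 B4 B5)) 1 q p
      = (deriv B2 (q 1) * p 1 ^ 2 + deriv B3 (q 1) * p 2 ^ 2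
          + 2 * deriv B4 (q 1) * (p 2 * p 3) + deriv B5 (q 1) * p 3 ^ 2
          - deriv B1 (q 1) * ham (BFG A1 A2 A3 A4 A5 B1 B2 B3 B4 B5) q p)
        / (A1 (q 0) + B1 (q 1)) := by
  rw [dQ, fderiv_single_eq_deriv_update (differentiableAt_ham_BFG_position p hA hB hD)]
  simp only [List.forall_mem_cons, List.not_mem_nil, false_imp_iff, implies_true, and_true] at hB
  obtain ⟨h1, h2, h3, h4, h5⟩ := hB
  simp only [ham_BFG, Function.update_self, ne_eq, zero_ne_one, not_false_eq_true,
    Function.update_of_ne]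
  have h := (((((h2.hasDerivAt.mul_const (p 1 ^ 2)).const_add (A2 (q 0) * p 0 ^ 2)).add
    ((h3.hasDerivAt.const_add (A3 (q 0))).mul_const (p 2 ^ 2))).add
    (((h4.hasDerivAt.const_add (A4 (q 0))).const_mul 2).mul_const (p 2 * p 3))).add
    ((h5.hasDerivAt.const_add (A5 (q 0))).mul_const (p 3 ^ 2))).div
    (h1.hasDerivAt.const_add (A1 (q 0))) hD
  refine h.deriv.trans ?_
  simp only [Pi.add_apply]
  field_simp

theorem dQ_cyclic_ham_BFG {q : Pt} (p : Pt)
    (hA : ∀ f ∈ [A1, A2, A3, A4, A5], DifferentiableAt ℝ f (q 0))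
    (hB : ∀ f ∈ [B1, B2, B3, B4, B5], DifferentiableAt ℝ f (q 1))
    (hD : A1 (q 0) + B1 (q 1) ≠ 0)
    {i : Fin 4} (hi0 : i ≠ 0) (hi1 : i ≠ 1) :
    dQ (ham (BFG A1 A2 A3 A4 A5 B1 B2 B3 B4 B5)) i q p = 0 := by
  rw [dQ, fderiv_single_eq_deriv_update (differentiableAt_ham_BFG_position p hA hB hD)]
  simp [ham_BFG, Function.update_of_ne hi0.symm, Function.update_of_ne hi1.symm]

end

theorem benenti_francaviglia_fourth_integral
    (I J : Set ℝ) (hIopen : IsOpen I) (hIint : Set.OrdConnected I)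
    (hJopen : IsOpen J) (hJint : Set.OrdConnected J)
    (A1 A2 A3 A4 A5 B1 B2 B3 B4 B5 : ℝ → ℝ)
    (hA : ∀ f ∈ [A1, A2, A3, A4, A5], ContDiffOn ℝ (⊤ : ℕ∞) f I)
    (hB : ∀ f ∈ [B1, B2, B3, B4, B5], ContDiffOn ℝ (⊤ : ℕ∞) f J)
    (T : Set ℝ) (hTopen : IsOpen T) (hTint : Set.OrdConnected T)
    (q p : ℝ → Pt)
    (hqU : ∀ τ ∈ T, q τ 0 ∈ I ∧ q τ 1 ∈ J ∧ A1 (q τ 0) + B1 (q τ 1) ≠ 0)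
    (hqdiff : ∀ i, ∀ τ ∈ T, DifferentiableAt ℝ (fun t => q t i) τ)
    (hpdiff : ∀ i, ∀ τ ∈ T, DifferentiableAt ℝ (fun t => p t i) τ)
    (hHamQ : ∀ τ ∈ T, ∀ i, deriv (fun t => q t i) τ
      = dP (ham (BFG A1 A2 A3 A4 A5 B1 B2 B3 B4 B5)) i (q τ) (p τ))
    (hHamP : ∀ τ ∈ T, ∀ i, deriv (fun t => p t i) τ
      = - dQ (ham (BFG A1 A2 A3 A4 A5 B1 B2 B3 B4 B5)) i (q τ) (p τ)) :
    ∀ τ₁ ∈ T, ∀ τ₂ ∈ T,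
      ham (BFK A1 A2 A3 A4 A5 B1 B2 B3 B4 B5) (q τ₁) (p τ₁)
        = ham (BFK A1 A2 A3 A4 A5 B1 B2 B3 B4 B5) (q τ₂) (p τ₂) := by
  have hmain : ∀ τ ∈ T, HasDerivAt
      (fun t => ham (BFK A1 A2 A3 A4 A5 B1 B2 B3 B4 B5) (q t) (p t)) 0 τ := by
    intro τ hτ
    obtain ⟨hI, hJ, hD⟩ := hqU τ hτ
    have hA' : ∀ f ∈ [A1, A2, A3, A4, A5], DifferentiableAt ℝ f (q τ 0) := fun f hf =>
      ((hA f hf).contDiffAt (hIopen.mem_nhds hI)).differentiableAt (by simp)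
    have hB' : ∀ f ∈ [B1, B2, B3, B4, B5], DifferentiableAt ℝ f (q τ 1) := fun f hf =>
      ((hB f hf).contDiffAt (hJopen.mem_nhds hJ)).differentiableAt (by simp)
    have hq0 := (hqdiff 0 τ hτ).hasDerivAt
    have hq1 := (hqdiff 1 τ hτ).hasDerivAt
    have hp0 := (hpdiff 0 τ hτ).hasDerivAt
    have hp1 := (hpdiff 1 τ hτ).hasDerivAt
    have hp2 := (hpdiff 2 τ hτ).hasDerivAt
    have hp3 := (hpdiff 3 τ hτ).hasDerivAt
    rw [hHamQ τ hτ, dP_zero_ham_BFG] at hq0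
    rw [hHamQ τ hτ, dP_one_ham_BFG] at hq1
    rw [hHamP τ hτ, dQ_zero_ham_BFG _ hA' hB' hD, ham_BFG] at hp0
    rw [hHamP τ hτ, dQ_one_ham_BFG _ hA' hB' hD, ham_BFG] at hp1
    rw [hHamP τ hτ, dQ_cyclic_ham_BFG _ hA' hB' hD (by decide) (by decide), neg_zero] at hp2 hp3
    simp only [List.forall_mem_cons, List.not_mem_nil, false_imp_iff, implies_true,
      and_true] at hA' hB'
    obtain ⟨h1, h2, h3, h4, h5⟩ := hA'
    obtain ⟨k1, k2, k3, k4, k5⟩ := hB'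
    have a1 := h1.hasDerivAt.comp τ hq0
    have a2 := h2.hasDerivAt.comp τ hq0
    have a3 := h3.hasDerivAt.comp τ hq0
    have a4 := h4.hasDerivAt.comp τ hq0
    have a5 := h5.hasDerivAt.comp τ hq0
    have b1 := k1.hasDerivAt.comp τ hq1
    have b2 := k2.hasDerivAt.comp τ hq1
    have b3 := k3.hasDerivAt.comp τ hq1
    have b4 := k4.hasDerivAt.comp τ hq1
    have b5 := k5.hasDerivAt.comp τ hq1
    have hX := (((a2.mul (hp0.pow 2)).add (a3.mul (hp2.pow 2))).add
      ((a4.const_mul 2).mul (hp2.mul hp3))).add (a5.mul (hp3.pow 2))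
    have hY := (((b2.mul (hp1.pow 2)).add (b3.mul (hp2.pow 2))).add
      ((b4.const_mul 2).mul (hp2.mul hp3))).add (b5.mul (hp3.pow 2))
    have hK := ((b1.mul hX).sub (a1.mul hY)).div (a1.add b1) hD
    simp only [ham_BFK]
    refine hK.congr_deriv ?_
    simp only [Pi.add_apply, Pi.mul_apply, Pi.sub_apply, Pi.pow_apply, Function.comp_apply]
    field_simp
    ring
  intro τ₁ h₁ τ₂ h₂
  exact hTopen.is_const_of_deriv_eq_zero hTint.isPreconnected
    (fun τ hτ => (hmain τ hτ).differentiableAt.differentiableWithinAt)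
    (fun τ hτ => (hmain τ hτ).deriv) h₁ h₂
end
end
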